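/- Let n ≥ 0, let g ∈ 𝔽_q[T] be monic, ℓ ∈ 𝔽_q[T] monic with deg ℓ ≥ 1, and c ∈ 𝔽_q[T] with gcd(ℓc, g) = 1; let χ be a primitive (hence non-principal) Dirichlet character modulo ℓ. Then the rational function u ↦ R_2(u;χ,c/g) has at most a simple pole at u = 1/q, and lim_{u → 1/q} (u − 1/q)·R_2(u;χ,c/g)·u^{−(n+1)} = −q^n·χ(g)·L(1,χ)/|g|; equivalently, the residue at u = 1/q of R_2(u;χ,c/g)/u^{n+1} equals −q^n·χ(g)·L(1,χ)/|g|. -/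

import Mathlib

open Polynomial
open scoped Classical

noncomputable section

/-- The canonical additive character of a finite field `F`:
`e_q(y) = exp(2πi·Tr(y)/p)` where `p` is the characteristic. -/
def eChar (F : Type) [Field F] [Fintype F] (y : F) : ℂ :=
  letI : Algebra (ZMod (ringChar F)) F := ZMod.algebra F (ringChar F)
  Complex.exp (2 * Real.pi * Complex.I *
    ((Algebra.trace (ZMod (ringChar F)) F y).val : ℂ) / (ringChar F : ℂ))

variable {F : Type} [Field F] [Fintype F]

/-- `e(a/g) = e_q(coefficient of T^(deg g - 1) of (a mod g))`. -/
def eFrac (a g : Polynomial F) : ℂ :=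
  eChar F ((a % g).coeff (g.natDegree - 1))

/-- Number of monic divisors of a polynomial. -/
def dCount (f : Polynomial F) : ℕ :=
  Set.ncard {g : Polynomial F | g.Monic ∧ g ∣ f}

/-- `r_χ(f) = Σ_{g monic, g ∣ f} χ(g)`. -/
def rChi (χ : Polynomial F → ℂ) (f : Polynomial F) : ℂ :=
  ∑ᶠ g ∈ {g : Polynomial F | g.Monic ∧ g ∣ f}, χ g

/-- A Dirichlet character modulo `ℓ`: a function induced by a group homomorphism
`(F[T]/(ℓ))^× → ℂ^×`, extended by zero on non-coprime arguments. -/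
def IsDirichletChar (ℓ : Polynomial F) (χ : Polynomial F → ℂ) : Prop :=
  (∀ f g : Polynomial F, f % ℓ = g % ℓ → χ f = χ g) ∧
  (∀ f g : Polynomial F, χ (f * g) = χ f * χ g) ∧ χ 1 = 1 ∧
  ∀ f : Polynomial F, χ f = 0 ↔ ¬ IsCoprime f ℓ

/-- Primitivity: `χ` is not induced by a character modulo a proper (monic) divisor of `ℓ`. -/
def IsPrimitiveChar (ℓ : Polynomial F) (χ : Polynomial F → ℂ) : Prop :=
  IsDirichletChar ℓ χ ∧
  ∀ ℓ' : Polynomial F, ℓ'.Monic → ℓ' ∣ ℓ → ℓ' ≠ ℓ →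
    ¬ ∃ χ' : Polynomial F → ℂ, IsDirichletChar ℓ' χ' ∧
      ∀ f : Polynomial F, IsCoprime f ℓ → χ f = χ' f

/-- Complex conjugate character. -/
def conjChar (χ : Polynomial F → ℂ) : Polynomial F → ℂ := fun f => starRingEnd ℂ (χ f)

/-- `L(s,χ) = Σ_{f monic} χ(f)|f|^{-s}`, summed by degree. -/
def LFun (χ : Polynomial F → ℂ) (s : ℂ) : ℂ :=
  ∑' n : ℕ, (∑ᶠ f ∈ {f : Polynomial F | f.Monic ∧ f.natDegree = n}, χ f) *
    (Fintype.card F : ℂ) ^ (-(s * (n : ℂ)))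

/-- Gauss sum `G(χ) = Σ_{deg a < deg ℓ} χ(a)·e(a/ℓ)`. -/
def GSum (ℓ : Polynomial F) (χ : Polynomial F → ℂ) : ℂ :=
  ∑ᶠ a ∈ {a : Polynomial F | a.degree < ℓ.degree}, χ a * eFrac a ℓ

/-- Kloosterman sum over `F`. -/
def Kl2 (α β : F) : ℂ :=
  ∑ γ : Fˣ, eChar F (α * (γ : F) + β * ((γ⁻¹ : Fˣ) : F))

/-- Twisted Kloosterman sum over `F`. -/
def KlChi (χ : Polynomial F → ℂ) (α β : F) : ℂ :=
  ∑ γ : Fˣ, χ (Polynomial.C (γ : F)) * eChar F (α * (γ : F) + β * ((γ⁻¹ : Fˣ) : F))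

/-- Gauss sum of the restriction of `χ` to `F`. -/
def tauChi (χ : Polynomial F → ℂ) (α : F) : ℂ :=
  ∑ γ : Fˣ, χ (Polynomial.C (γ : F)) * eChar F (α * (γ : F))

/-- Generalized binomial coefficient `C(-m, j)`. -/
def negBinom (m j : ℕ) : ℤ :=
  if m = 0 then (if j = 0 then 1 else 0) else (-1) ^ j * (Nat.choose (m + j - 1) j)

/-- The coefficients `b_k(χ; λ, η₁, η₂)` of the Voronoi summation formula. -/
def bCoeff (χ : Polynomial F → ℂ) (lam : F) (η₁ η₂ k : ℕ) : ℂ :=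
  (-1 : ℂ) ^ (k - η₁ - η₂) * KlChi χ ((η₁ : F) - 1) ((1 - (η₂ : F)) * lam) *
    (if η₁ + η₂ ≤ k then (negBinom (η₁ + η₂) (k - η₁ - η₂) : ℂ) else 0)

/-- The untwisted coefficients `b_k(λ, η₁, η₂)`. -/
def bCoeffD (lam : F) (η₁ η₂ k : ℕ) : ℂ :=
  (-1 : ℂ) ^ (k - η₁ - η₂) * Kl2 ((η₁ : F) - 1) ((1 - (η₂ : F)) * lam) *
    (if η₁ + η₂ ≤ k then (negBinom (η₁ + η₂) (k - η₁ - η₂) : ℂ) else 0)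

/-- The series `Σ_{f monic} c(f)·u^{deg f}` (as a `tsum`). -/
def monicSeries (c : Polynomial F → ℂ) (u : ℂ) : ℂ :=
  ∑' f : {f : Polynomial F // f.Monic}, c f * u ^ (f : Polynomial F).natDegree

/-- `φ` is the rational continuation of the series `u ↦ Σ_{f monic} c(f)·u^{deg f}`:
it agrees with the (convergent) series on `‖u‖ < 1/q` and is a rational function. -/
def IsRatCont (c : Polynomial F → ℂ) (φ : ℂ → ℂ) : Prop :=
  (∃ P Q : Polynomial ℂ, IsCoprime P Q ∧ Q ≠ 0 ∧
    ∀ z : ℂ, Q.eval z ≠ 0 → φ z = P.eval z / Q.eval z) ∧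
  ∀ u : ℂ, ‖u‖ < 1 / (Fintype.card F) →
    HasSum (fun f : {f : Polynomial F // f.Monic} => c f * u ^ (f : Polynomial F).natDegree)
      (φ u)

end

section FiniteSetsOfPolynomials

variable (F : Type) [Field F] [Fintype F]

lemma finite_setOf_degree_lt (k : ℕ) : {p : F[X] | p.degree < k}.Finite := by
  have : Finite (degreeLT F k) := Finite.of_equiv _ (degreeLTEquiv F k).toEquiv.symm
  refine (Set.toFinite (degreeLT F k : Set F[X])).subset fun p hp => ?_
  exact mem_degreeLT.2 hp

/-- The polynomials of degree less than `k`. -/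
noncomputable def polysDegreeLT (k : ℕ) : Finset F[X] := (finite_setOf_degree_lt F k).toFinset

/-- The monic polynomials of degree `k`. -/
noncomputable def monicsOfDegree (k : ℕ) : Finset F[X] := (polysDegreeLT F k).image (X ^ k + ·)

variable {F}

lemma mem_polysDegreeLT {k : ℕ} {p : F[X]} : p ∈ polysDegreeLT F k ↔ p.degree < k := by
  simp [polysDegreeLT]

lemma mem_monicsOfDegree {k : ℕ} {p : F[X]} :
    p ∈ monicsOfDegree F k ↔ p.Monic ∧ p.natDegree = k := by
  simp only [monicsOfDegree, Finset.mem_image, mem_polysDegreeLT]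
  constructor
  · rintro ⟨h, hh, rfl⟩
    refine ⟨monic_X_pow_add hh, ?_⟩
    rw [natDegree_add_eq_left_of_degree_lt (by simpa using hh), natDegree_X_pow]
  · rintro ⟨hp, rfl⟩
    refine ⟨p - X ^ p.natDegree, ?_, by ring⟩
    have := degree_sub_lt_left (p := p) (q := X ^ p.natDegree)
      (by rw [degree_X_pow, degree_eq_natDegree hp.ne_zero]) hp.ne_zero (by simp [hp.leadingCoeff])
    rwa [degree_eq_natDegree hp.ne_zero] at this

lemma card_monicsOfDegree (k : ℕ) : (monicsOfDegree F k).card = Fintype.card F ^ k := by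
  rw [monicsOfDegree, Finset.card_image_of_injective _ (add_right_injective _)]
  have : Nat.card (degreeLT F k) = Fintype.card F ^ k := by
    rw [Nat.card_congr (degreeLTEquiv F k).toEquiv]
    simp
  rw [← this, ← Nat.card_eq_finsetCard]
  exact Nat.card_congr (Equiv.subtypeEquivRight fun p => by
    rw [mem_polysDegreeLT, mem_degreeLT])

lemma sum_monicsOfDegree_add {k : ℕ} {h : F[X]} (hh : h.degree < k) (w : F[X] → ℂ) :
    ∑ d ∈ monicsOfDegree F k, w (d + h) = ∑ d ∈ monicsOfDegree F k, w d := by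
  have key : ∀ e : F[X], e.degree < k → ∀ d ∈ monicsOfDegree F k, d + e ∈ monicsOfDegree F k := by
    intro e he d hd
    rw [mem_monicsOfDegree] at hd ⊢
    have : e.degree < d.degree := by rwa [degree_eq_natDegree hd.1.ne_zero, hd.2]
    exact ⟨hd.1.add_of_left this, by rw [natDegree_add_eq_left_of_degree_lt this, hd.2]⟩
  exact Finset.sum_nbij' (· + h) (· - h) (key h hh)
    (fun d hd => by simpa [sub_eq_add_neg] using key (-h) (by simpa using hh) d hd)
    (by simp) (by simp) (by simp)

end FiniteSetsOfPolynomials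

section AdditiveCharacter

variable {F : Type} [Field F] [Fintype F]

lemma exists_addChar_eq_eChar : ∃ ψ : AddChar F ℂ, (∀ y, eChar F y = ψ y) ∧ ψ ≠ 1 := by
  let _ : Algebra (ZMod (ringChar F)) F := ZMod.algebra F (ringChar F)
  have : Fact (ringChar F).Prime := ⟨CharP.char_is_prime F _⟩
  refine ⟨ZMod.stdAddChar.compAddMonoidHom
    (Algebra.trace (ZMod (ringChar F)) F).toAddMonoidHom, fun y => ?_, fun h => ?_⟩
  · simp only [AddChar.compAddMonoidHom_apply, ZMod.stdAddChar_apply, ZMod.toCircle_apply]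
    rfl
  · obtain ⟨b, hb⟩ := FiniteField.trace_to_zmod_nondegenerate F (one_ne_zero (α := F))
    apply hb
    have := DFunLike.congr_fun h (1 * b)
    apply ZMod.injective_stdAddChar
    simpa using this

lemma eChar_zero : eChar F 0 = 1 := by
  obtain ⟨ψ, hψ, -⟩ := exists_addChar_eq_eChar (F := F)
  simp [hψ]

lemma eChar_add (x y : F) : eChar F (x + y) = eChar F x * eChar F y := by
  obtain ⟨ψ, hψ, -⟩ := exists_addChar_eq_eChar (F := F)
  simp [hψ, AddChar.map_add_eq_mul]

lemma exists_eChar_ne_one : ∃ y : F, eChar F y ≠ 1 := by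
  obtain ⟨ψ, hψ, h⟩ := exists_addChar_eq_eChar (F := F)
  obtain ⟨y, hy⟩ := AddChar.ne_one_iff.1 h
  exact ⟨y, by rwa [hψ]⟩

lemma eFrac_add (a b g : F[X]) : eFrac (a + b) g = eFrac a g * eFrac b g := by
  simp [eFrac, add_mod, eChar_add]

lemma eFrac_of_dvd {a g : F[X]} (h : g ∣ a) : eFrac a g = 1 := by
  rw [eFrac, (EuclideanDomain.mod_eq_zero).2 h, coeff_zero, eChar_zero]

lemma exists_eFrac_mul_ne_one {a g : F[X]} (hg : g.Monic) (h : ¬ g ∣ a) :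
    ∃ b : F[X], b.degree < g.natDegree ∧ eFrac (a * b) g ≠ 1 := by
  obtain ⟨y, hy⟩ := exists_eChar_ne_one (F := F)
  have hr : a % g ≠ 0 := fun h0 => h ((EuclideanDomain.mod_eq_zero).1 h0)
  set r := a % g with hrdef
  have hrd : r.natDegree < g.natDegree := by
    have := degree_mod_lt a hg.ne_zero
    rw [← hrdef, degree_eq_natDegree hr, degree_eq_natDegree hg.ne_zero] at this
    exact_mod_cast this
  have hb : (C (y / r.leadingCoeff) * X ^ (g.natDegree - 1 - r.natDegree) : F[X]).degree
      < g.natDegree :=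
    (degree_C_mul_X_pow_le _ _).trans_lt (by norm_cast; omega)
  refine ⟨_, hb, ?_⟩
  have hmod : (a * (C (y / r.leadingCoeff) * X ^ (g.natDegree - 1 - r.natDegree))) % g
      = r * (C (y / r.leadingCoeff) * X ^ (g.natDegree - 1 - r.natDegree)) := by
    refine (mod_eq_of_dvd_sub ?_).trans ((mod_eq_self_iff hg.ne_zero).2 ?_)
    · rw [← sub_mul]
      refine Dvd.dvd.mul_right ⟨a / g, ?_⟩ _
      rw [hrdef, EuclideanDomain.mod_eq_sub_mul_div]
      ring
    · rw [degree_mul, degree_eq_natDegree hr, degree_eq_natDegree hg.ne_zero]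
      calc _ ≤ (r.natDegree : WithBot ℕ) + ((g.natDegree - 1 - r.natDegree : ℕ) : WithBot ℕ) :=
            add_le_add le_rfl (degree_C_mul_X_pow_le _ _)
        _ < g.natDegree := by norm_cast; omega
  have hcoeff : (r * (C (y / r.leadingCoeff) * X ^ (g.natDegree - 1 - r.natDegree))).coeff
      (g.natDegree - 1) = y := by
    rw [← mul_assoc, coeff_mul_X_pow', if_pos (by omega), coeff_mul_C,
      show g.natDegree - 1 - (g.natDegree - 1 - r.natDegree) = r.natDegree by omega,
      coeff_natDegree, mul_div_cancel₀ _ (leadingCoeff_ne_zero.2 hr)]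
  rwa [eFrac, hmod, hcoeff]

lemma sum_monicsOfDegree_eFrac {g : F[X]} (hg : g.Monic) (a : F[X]) {j : ℕ}
    (hj : g.natDegree ≤ j) :
    ∑ m ∈ monicsOfDegree F j, eFrac (a * m) g = if g ∣ a then (Fintype.card F : ℂ) ^ j else 0 := by
  split_ifs with h
  · rw [Finset.sum_congr rfl fun m _ => eFrac_of_dvd (h.mul_right m)]
    simp [card_monicsOfDegree]
  · obtain ⟨b, hb, hne⟩ := exists_eFrac_mul_ne_one hg h
    have hbj : b.degree < j := hb.trans_le (by exact_mod_cast hj)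
    have := sum_monicsOfDegree_add hbj fun m => eFrac (a * m) g
    simp only [mul_add, eFrac_add, ← Finset.sum_mul] at this
    by_contra h0
    exact hne (mul_left_cancel₀ h0 (by rw [this, mul_one]))

end AdditiveCharacter

section DirichletCharacter

lemma IsPrimitiveChar.exists_ne_one {F : Type} [Field F] {ℓ : F[X]} {χ : F[X] → ℂ}
    (hχ : IsPrimitiveChar ℓ χ) (hdeg : 1 ≤ ℓ.natDegree) :
    ∃ b, IsCoprime b ℓ ∧ χ b ≠ 1 := by
  by_contra! H
  refine hχ.2 1 monic_one (one_dvd ℓ) (by rintro rfl; simp at hdeg) ⟨fun _ => 1, ?_, H⟩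
  refine ⟨by simp, by simp, rfl, fun f => ?_⟩
  simp [isCoprime_one_right]

variable {F : Type} [Field F] [Fintype F] {ℓ : F[X]} {χ : F[X] → ℂ}

lemma IsDirichletChar.sum_polysDegreeLT_add_mul (hχ : IsDirichletChar ℓ χ) (hℓ : ℓ.Monic)
    (v : F[X]) {w : F[X]} (hw : IsCoprime ℓ w) :
    ∑ h ∈ polysDegreeLT F ℓ.natDegree, χ (v + w * h) =
      ∑ h ∈ polysDegreeLT F ℓ.natDegree, χ h := by
  have hdeg : ∀ p : F[X], p ∈ polysDegreeLT F ℓ.natDegree ↔ p.degree < ℓ.degree := fun p => by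
    rw [mem_polysDegreeLT, degree_eq_natDegree hℓ.ne_zero]
  have hmaps : Set.MapsTo (fun h => (v + w * h) % ℓ) (polysDegreeLT F ℓ.natDegree)
      (polysDegreeLT F ℓ.natDegree) := fun h _ => (hdeg _).2 (degree_mod_lt _ hℓ.ne_zero)
  have hinj : Set.InjOn (fun h => (v + w * h) % ℓ) (polysDegreeLT F ℓ.natDegree) := by
    intro x hx y hy hxy
    rw [Finset.mem_coe, hdeg] at hx hy
    have h1 : (w * (x - y)) % ℓ = 0 := by
      rw [show w * (x - y) = (v + w * x) - (v + w * y) by ring, sub_mod]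
      exact sub_eq_zero.2 hxy
    have h2 : ℓ ∣ x - y := hw.dvd_of_dvd_mul_left (EuclideanDomain.mod_eq_zero.1 h1)
    refine sub_eq_zero.1 (eq_zero_of_dvd_of_degree_lt h2 ?_)
    exact (degree_sub_le _ _).trans_lt (max_lt hx hy)
  refine Finset.sum_nbij _ hmaps hinj (Finset.surjOn_of_injOn_of_card_le _ hmaps hinj le_rfl)
    fun h _ => hχ.1 _ _ ?_
  exact ((mod_eq_self_iff hℓ.ne_zero).2 (degree_mod_lt _ hℓ.ne_zero)).symm

lemma IsPrimitiveChar.sum_polysDegreeLT_eq_zero (hχ : IsPrimitiveChar ℓ χ) (hℓ : ℓ.Monic)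
    (hdeg : 1 ≤ ℓ.natDegree) : ∑ h ∈ polysDegreeLT F ℓ.natDegree, χ h = 0 := by
  obtain ⟨b, hb, hne⟩ := hχ.exists_ne_one hdeg
  have := hχ.1.sum_polysDegreeLT_add_mul hℓ 0 hb.symm
  simp only [zero_add, hχ.1.2.1, ← Finset.mul_sum] at this
  by_contra h0
  exact hne (mul_right_cancel₀ h0 (by rw [this, one_mul]))

lemma IsPrimitiveChar.sum_monicsOfDegree_mul_eFrac_eq_zero (hχ : IsPrimitiveChar ℓ χ)
    (hℓ : ℓ.Monic) (hdeg : 1 ≤ ℓ.natDegree) {g : F[X]} (hg : g.Monic) (hcop : IsCoprime ℓ g)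
    (a : F[X]) {i : ℕ} (hi : g.natDegree + ℓ.natDegree ≤ i) :
    ∑ d ∈ monicsOfDegree F i, χ d * eFrac (a * d) g = 0 := by
  have hshift : ∀ h ∈ polysDegreeLT F ℓ.natDegree,
      ∑ d ∈ monicsOfDegree F i, χ (d + g * h) * eFrac (a * d) g
        = ∑ d ∈ monicsOfDegree F i, χ d * eFrac (a * d) g := by
    intro h hh
    rw [mem_polysDegreeLT] at hh
    have hlt : (g * h).degree < i := by
      rcases eq_or_ne h 0 with rfl | h0
      · simp
      · rw [degree_mul, degree_eq_natDegree hg.ne_zero, degree_eq_natDegree h0]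
        rw [degree_eq_natDegree h0] at hh
        norm_cast at hh ⊢
        omega
    rw [← sum_monicsOfDegree_add hlt fun d => χ d * eFrac (a * d) g]
    refine Finset.sum_congr rfl fun d _ => ?_
    rw [mul_add, eFrac_add, eFrac_of_dvd (a := a * (g * h)) ⟨a * h, by ring⟩, mul_one]
  have hcard := Finset.sum_congr rfl hshift
  rw [Finset.sum_comm, Finset.sum_const] at hcard
  simp only [← Finset.sum_mul, hχ.1.sum_polysDegreeLT_add_mul hℓ _ hcop,
    hχ.sum_polysDegreeLT_eq_zero hℓ hdeg, zero_mul, Finset.sum_const_zero] at hcard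
  refine (smul_eq_zero.1 hcard.symm).resolve_left (Finset.card_ne_zero_of_mem (a := 0) ?_)
  rw [mem_polysDegreeLT]
  simp

lemma IsPrimitiveChar.sum_monicsOfDegree_eq_zero (hχ : IsPrimitiveChar ℓ χ)
    (hℓ : ℓ.Monic) (hdeg : 1 ≤ ℓ.natDegree) {k : ℕ} (hk : ℓ.natDegree ≤ k) :
    ∑ d ∈ monicsOfDegree F k, χ d = 0 := by
  have := hχ.sum_monicsOfDegree_mul_eFrac_eq_zero hℓ hdeg monic_one isCoprime_one_right 0
    (i := k) (by simpa using hk)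
  simpa [eFrac_of_dvd] using this

lemma IsPrimitiveChar.LFun_one_eq_sum (hχ : IsPrimitiveChar ℓ χ) (hℓ : ℓ.Monic)
    (hdeg : 1 ≤ ℓ.natDegree) {K : ℕ} (hK : ℓ.natDegree ≤ K) :
    LFun χ 1 = ∑ k ∈ Finset.range K,
      (∑ d ∈ monicsOfDegree F k, χ d) / (Fintype.card F : ℂ) ^ k := by
  have hset : ∀ k : ℕ, {f : F[X] | f.Monic ∧ f.natDegree = k} = (monicsOfDegree F k : Set F[X]) :=
    fun k => by ext f; simp [mem_monicsOfDegree]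
  simp only [LFun, hset, finsum_mem_coe_finset]
  rw [tsum_eq_sum (s := Finset.range K)]
  · refine Finset.sum_congr rfl fun k _ => ?_
    rw [one_mul, Complex.cpow_neg, Complex.cpow_natCast, div_eq_mul_inv]
  · intro k hk
    rw [Finset.mem_range, not_lt] at hk
    rw [hχ.sum_monicsOfDegree_eq_zero hℓ hdeg (hK.trans hk), zero_mul]

end DirichletCharacter

section TwistedDivisorSums

variable {F : Type} [Field F] [Fintype F] {ℓ : F[X]} {χ : F[X] → ℂ}

lemma sum_monicsOfDegree_filter_dvd {g : F[X]} (hg : g.Monic) (w : F[X] → ℂ) (i : ℕ) :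
    ∑ d ∈ monicsOfDegree F i with g ∣ d, w d =
      if g.natDegree ≤ i then ∑ d ∈ monicsOfDegree F (i - g.natDegree), w (g * d) else 0 := by
  split_ifs with h
  · symm
    refine Finset.sum_nbij (g * ·) (fun d hd => ?_) (mul_right_injective₀ hg.ne_zero).injOn
      (fun d hd => ?_) fun _ _ => rfl
    · rw [mem_monicsOfDegree] at hd
      rw [Finset.mem_filter, mem_monicsOfDegree]
      refine ⟨⟨hg.mul hd.1, ?_⟩, dvd_mul_right g d⟩
      rw [hg.natDegree_mul hd.1]
      omega
    · rw [Finset.mem_coe, Finset.mem_filter, mem_monicsOfDegree] at hd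
      obtain ⟨⟨hd, hdeg⟩, e, rfl⟩ := hd
      have he := hg.of_mul_monic_left hd
      rw [hg.natDegree_mul he] at hdeg
      exact ⟨e, mem_monicsOfDegree.2 ⟨he, by omega⟩, rfl⟩
  · refine Finset.sum_eq_zero fun d hd => absurd ?_ h
    rw [Finset.mem_filter, mem_monicsOfDegree] at hd
    rw [← hd.1.2]
    exact natDegree_le_of_dvd hd.2 hd.1.1.ne_zero

lemma sum_monicsOfDegree_rChi_mul (χ w : F[X] → ℂ) (N : ℕ) :
    ∑ f ∈ monicsOfDegree F N, rChi χ f * w f =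
      ∑ i ∈ Finset.range (N + 1),
        ∑ d ∈ monicsOfDegree F i, ∑ m ∈ monicsOfDegree F (N - i), χ d * w (d * m) := by
  let S : Finset (F[X] × F[X]) := (Finset.range (N + 1)).biUnion fun i =>
    monicsOfDegree F i ×ˢ monicsOfDegree F (N - i)
  have hS : ∀ x : F[X] × F[X],
      x ∈ S ↔ x.1.Monic ∧ x.2.Monic ∧ x.1.natDegree + x.2.natDegree = N := by
    intro x
    simp only [S, Finset.mem_biUnion, Finset.mem_range, Finset.mem_product, mem_monicsOfDegree]
    constructor
    · rintro ⟨i, hi, ⟨h1, h2⟩, h3, h4⟩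
      exact ⟨h1, h3, by omega⟩
    · rintro ⟨h1, h2, h3⟩
      exact ⟨x.1.natDegree, by omega, ⟨h1, rfl⟩, h2, by omega⟩
  have hrChi : ∀ f ∈ monicsOfDegree F N, rChi χ f = ∑ x ∈ S with x.1 * x.2 = f, χ x.1 := by
    intro f hf
    rw [mem_monicsOfDegree] at hf
    have himage : {d : F[X] | d.Monic ∧ d ∣ f} =
        Prod.fst '' ((S.filter fun x => x.1 * x.2 = f : Finset _) : Set (F[X] × F[X])) := by
      ext d
      simp only [Set.mem_ofPred_eq, Set.mem_image, Finset.mem_coe, Finset.mem_filter, hS]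
      constructor
      · rintro ⟨hd, m, rfl⟩
        have hm := hd.of_mul_monic_left hf.1
        exact ⟨(d, m), ⟨⟨hd, hm, by rw [← hd.natDegree_mul hm, hf.2]⟩, rfl⟩, rfl⟩
      · rintro ⟨x, ⟨⟨h1, -⟩, rfl⟩, rfl⟩
        exact ⟨h1, dvd_mul_right _ _⟩
    rw [rChi, himage, finsum_mem_image, finsum_mem_coe_finset]
    rintro ⟨d, m⟩ hx ⟨d', m'⟩ hy (rfl : d = d')
    simp only [Finset.coe_filter, hS, Set.mem_ofPred_eq] at hx hy
    exact Prod.ext rfl (mul_left_cancel₀ hx.1.1.ne_zero (hx.2.trans hy.2.symm))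
  have hmaps : ∀ x ∈ S, x.1 * x.2 ∈ monicsOfDegree F N := by
    intro x hx
    rw [hS] at hx
    exact mem_monicsOfDegree.2 ⟨hx.1.mul hx.2.1, by rw [hx.1.natDegree_mul hx.2.1, hx.2.2]⟩
  have hdisj : ((Finset.range (N + 1) : Finset ℕ) : Set ℕ).PairwiseDisjoint fun i =>
      monicsOfDegree F i ×ˢ monicsOfDegree F (N - i) := by
    intro i _ j _ hij
    refine Finset.disjoint_left.2 fun x hx hy => hij ?_
    rw [Finset.mem_product, mem_monicsOfDegree] at hx hy
    rw [← hx.1.2, ← hy.1.2]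
  calc ∑ f ∈ monicsOfDegree F N, rChi χ f * w f
      = ∑ f ∈ monicsOfDegree F N, ∑ x ∈ S with x.1 * x.2 = f, χ x.1 * w (x.1 * x.2) := by
        refine Finset.sum_congr rfl fun f hf => ?_
        rw [hrChi f hf, Finset.sum_mul]
        exact Finset.sum_congr rfl fun x hx => by rw [(Finset.mem_filter.1 hx).2]
    _ = ∑ x ∈ S, χ x.1 * w (x.1 * x.2) := Finset.sum_fiberwise_of_maps_to hmaps _
    _ = _ := by
        rw [Finset.sum_biUnion hdisj]
        exact Finset.sum_congr rfl fun i _ => Finset.sum_product _ _ _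

lemma IsPrimitiveChar.sum_sum_mul_eFrac (hχ : IsPrimitiveChar ℓ χ)
    (hℓ : ℓ.Monic) (hdeg : 1 ≤ ℓ.natDegree) {g c : F[X]} (hg : g.Monic)
    (hℓg : IsCoprime ℓ g) (hcg : IsCoprime c g) {i j : ℕ}
    (hij : g.natDegree + ℓ.natDegree + g.natDegree ≤ i + j) :
    ∑ d ∈ monicsOfDegree F i, ∑ m ∈ monicsOfDegree F j, χ d * eFrac (c * (d * m)) g =
      if g.natDegree ≤ i then
        (Fintype.card F : ℂ) ^ j * χ g * ∑ d ∈ monicsOfDegree F (i - g.natDegree), χ d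
      else 0 := by
  rcases le_or_gt g.natDegree j with hj | hj
  · have hdvd : ∀ d, g ∣ c * d ↔ g ∣ d := fun d =>
      ⟨hcg.symm.dvd_of_dvd_mul_left, fun h => h.mul_left c⟩
    simp only [← Finset.mul_sum, ← mul_assoc c, sum_monicsOfDegree_eFrac hg _ hj, hdvd, mul_ite,
      mul_zero]
    rw [← Finset.sum_filter, sum_monicsOfDegree_filter_dvd hg]
    simp only [hχ.1.2.1, Finset.mul_sum]
    congr 1
    exact Finset.sum_congr rfl fun d _ => by ring
  · rw [if_pos (by omega), hχ.sum_monicsOfDegree_eq_zero hℓ hdeg (by omega), mul_zero,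
      Finset.sum_comm]
    refine Finset.sum_eq_zero fun m _ => ?_
    rw [← hχ.sum_monicsOfDegree_mul_eFrac_eq_zero hℓ hdeg hg hℓg (c * m) (i := i) (by omega)]
    exact Finset.sum_congr rfl fun d _ => by rw [mul_comm d m, mul_assoc]

lemma IsPrimitiveChar.sum_rChi_mul_eFrac (hχ : IsPrimitiveChar ℓ χ)
    (hℓ : ℓ.Monic) (hdeg : 1 ≤ ℓ.natDegree) {g c : F[X]} (hg : g.Monic)
    (hℓg : IsCoprime ℓ g) (hcg : IsCoprime c g) {N : ℕ}
    (hN : g.natDegree + ℓ.natDegree + g.natDegree ≤ N) :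
    ∑ f ∈ monicsOfDegree F N, rChi χ f * eFrac (c * f) g =
      χ g * LFun χ 1 / (Fintype.card F : ℂ) ^ g.natDegree * (Fintype.card F : ℂ) ^ N := by
  have hq : (Fintype.card F : ℂ) ≠ 0 := by exact_mod_cast Fintype.card_ne_zero
  rw [sum_monicsOfDegree_rChi_mul χ fun f => eFrac (c * f) g,
    Finset.sum_congr rfl fun i hi => hχ.sum_sum_mul_eFrac hℓ hdeg hg hℓg hcg
      (hN.trans (by have := Finset.mem_range.1 hi; omega)),
    show N + 1 = g.natDegree + (N + 1 - g.natDegree) by omega, Finset.sum_range_add,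
    Finset.sum_eq_zero fun i hi => if_neg (not_le.2 (Finset.mem_range.1 hi)), zero_add,
    hχ.LFun_one_eq_sum hℓ hdeg (K := N + 1 - g.natDegree) (by omega), Finset.mul_sum,
    Finset.sum_div, Finset.sum_mul]
  refine Finset.sum_congr rfl fun k hk => ?_
  rw [Finset.mem_range] at hk
  rw [if_pos (Nat.le_add_right _ _), Nat.add_sub_cancel_left]
  have hpow : (Fintype.card F : ℂ) ^ N = (Fintype.card F : ℂ) ^ (N - (g.natDegree + k)) *
      (Fintype.card F : ℂ) ^ g.natDegree * (Fintype.card F : ℂ) ^ k := by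
    rw [← pow_add, ← pow_add]
    congr 1
    omega
  rw [hpow]
  field_simp

lemma hasSum_sum_monicsOfDegree {a : F[X] → ℂ} {u s : ℂ}
    (h : HasSum (fun f : {f : F[X] // f.Monic} => a f * u ^ (f : F[X]).natDegree) s) :
    HasSum (fun N => (∑ f ∈ monicsOfDegree F N, a f) * u ^ N) s := by
  let e := Equiv.sigmaFiberEquiv fun f : {f : F[X] // f.Monic} => (f : F[X]).natDegree
  refine (e.hasSum_iff.2 h).sigma fun N => ?_
  let e' : {f : {f : F[X] // f.Monic} // (f : F[X]).natDegree = N} ≃ monicsOfDegree F N :=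
    (Equiv.subtypeSubtypeEquivSubtypeInter (fun f : F[X] => f.Monic)
      fun f : F[X] => f.natDegree = N).trans
      (Equiv.subtypeEquivRight fun f => mem_monicsOfDegree.symm)
  rw [← e'.symm.hasSum_iff, Finset.sum_mul, ← Finset.sum_coe_sort]
  convert hasSum_fintype (fun f : monicsOfDegree F N => a f * u ^ N) using 2 with f
  have := (mem_monicsOfDegree.1 f.2).2
  change a f * u ^ (f : F[X]).natDegree = _
  rw [this]

end TwistedDivisorSums

/-- A power series whose coefficients are eventually `C * q ^ N` has at most a simple pole at
`1 / q`. -/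
lemma hasSum_eventually_geometric {q : ℕ} (hq : 0 < q) {A : ℕ → ℂ} {C : ℂ} {N₀ : ℕ}
    (hA : ∀ N, N₀ ≤ N → A N = C * (q : ℂ) ^ N) {u s : ℂ} (hu : ‖u‖ < 1 / q)
    (h : HasSum (fun N => A N * u ^ N) s) :
    (1 - q * u) * s = (1 - q * u) * ∑ N ∈ Finset.range N₀, A N * u ^ N + C * (q * u) ^ N₀ := by
  have hq' : (0 : ℝ) < q := by exact_mod_cast hq
  have hnorm : ‖(q : ℂ) * u‖ < 1 := by
    rw [norm_mul, Complex.norm_natCast, mul_comm]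
    exact (lt_div_iff₀ hq').1 hu
  have htail : HasSum (fun k => A (k + N₀) * u ^ (k + N₀)) (C * (q * u) ^ N₀ * (1 - q * u)⁻¹) := by
    refine ((hasSum_geometric_of_norm_lt_one hnorm).mul_left (C * (q * u) ^ N₀)).congr_fun
      fun k => ?_
    rw [hA _ (Nat.le_add_left _ _)]
    ring
  have hne : 1 - (q : ℂ) * u ≠ 0 := by
    intro h0
    rw [← sub_eq_zero.1 h0] at hnorm
    simp at hnorm
  rw [sub_eq_iff_eq_add.1 (((hasSum_nat_add_iff' N₀).2 h).unique htail)]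
  field_simp
  ring

lemma tendsto_residue_of_eventually_geometric {q : ℕ} (hq : 0 < q) {A : ℕ → ℂ} {C : ℂ} {N₀ : ℕ}
    (hA : ∀ N, N₀ ≤ N → A N = C * (q : ℂ) ^ N) {φ : ℂ → ℂ} {P Q : ℂ[X]} (hQ : Q ≠ 0)
    (hφ : ∀ z, Q.eval z ≠ 0 → φ z = P.eval z / Q.eval z)
    (hsum : ∀ u : ℂ, ‖u‖ < 1 / q → HasSum (fun N => A N * u ^ N) (φ u)) (n : ℕ) :
    Filter.Tendsto (fun u : ℂ => (u - 1 / (q : ℂ)) * φ u / u ^ (n + 1))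
      (nhdsWithin (1 / (q : ℂ)) {(1 / (q : ℂ))}ᶜ) (nhds (-((q : ℂ) ^ n * C))) := by
  have hq' : (0 : ℝ) < q := by exact_mod_cast hq
  have hqc : (q : ℂ) ≠ 0 := by exact_mod_cast hq.ne'
  let R : ℂ[X] := (1 - Polynomial.C (q : ℂ) * X) *
    ∑ N ∈ Finset.range N₀, Polynomial.C (A N) * X ^ N +
      Polynomial.C C * (Polynomial.C (q : ℂ) * X) ^ N₀
  have hR : ∀ u, R.eval u = (1 - q * u) * ∑ N ∈ Finset.range N₀, A N * u ^ N +
      C * (q * u) ^ N₀ := fun u => by simp [R, eval_finsetSum]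
  have hfin : {u | Q.eval u = 0}.Finite := by
    refine Q.roots.toFinset.finite_toSet.subset fun u hu => ?_
    simpa [hQ] using hu
  have hident : (1 - Polynomial.C (q : ℂ) * X) * P = Q * R := by
    refine eq_of_infinite_eval_eq _ _ ?_
    have hball : (Metric.ball (0 : ℂ) (1 / q)).Infinite :=
      infinite_of_mem_nhds 0 (Metric.ball_mem_nhds 0 (by positivity))
    refine (hball.sdiff hfin).mono fun u hu => ?_
    have hu1 : ‖u‖ < 1 / q := by simpa using hu.1
    have hQu : Q.eval u ≠ 0 := hu.2
    have h1 := hasSum_eventually_geometric hq hA hu1 (hsum u hu1)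
    rw [← hR, hφ u hQu] at h1
    simp only [Set.mem_ofPred_eq, eval_mul, eval_sub, eval_one, eval_C, eval_X]
    rw [← h1]
    field_simp
  have hev : ∀ᶠ u in nhdsWithin (1 / (q : ℂ)) {(1 / (q : ℂ))}ᶜ,
      -(1 / (q : ℂ)) * R.eval u / u ^ (n + 1) = (u - 1 / (q : ℂ)) * φ u / u ^ (n + 1) := by
    have hcof : ∀ᶠ u in nhdsWithin (1 / (q : ℂ)) {(1 / (q : ℂ))}ᶜ, Q.eval u ≠ 0 :=
      nhdsNE_le_cofinite _ hfin.compl_mem_cofinite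
    filter_upwards [hcof] with u hu
    have h1 := congrArg (eval u) hident
    simp only [eval_mul, eval_sub, eval_one, eval_C, eval_X] at h1
    rw [hφ u hu, show R.eval u = (1 - q * u) * P.eval u / Q.eval u by
      rw [h1, mul_div_cancel_left₀ _ hu]]
    congr 1
    field_simp
    ring
  refine Filter.Tendsto.congr' hev (Filter.Tendsto.mono_left ?_ nhdsWithin_le_nhds)
  have hcont : ContinuousAt (fun u : ℂ => -(1 / (q : ℂ)) * R.eval u / u ^ (n + 1)) (1 / (q : ℂ)) :=
    (continuousAt_const.mul R.continuous.continuousAt).div (by fun_prop)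
      (pow_ne_zero _ (one_div_ne_zero hqc))
  convert hcont.tendsto using 2
  rw [hR, mul_one_div_cancel hqc, one_pow, sub_self, zero_mul, zero_add, mul_one, one_div, inv_pow,
    div_inv_eq_mul, pow_succ]
  field_simp

/-- **Residue of `R_2(u;χ,c/g)/u^{n+1}` at `u = 1/q`:** the rational continuation of
`R_2(u;χ,c/g)` has at most a simple pole at `u = 1/q`, and
`lim_{u → 1/q} (u - 1/q)·R_2(u;χ,c/g)·u^{-(n+1)} = -q^n·χ(g)·L(1,χ)/|g|`. -/
theorem twistedR2_residue
    (F : Type) [Field F] [Fintype F] (q : ℕ) (hq : q = Fintype.card F)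
    (n : ℕ) (g ℓ c : Polynomial F)
    (hg : g.Monic) (hℓ : ℓ.Monic) (hℓdeg : 1 ≤ ℓ.natDegree)
    (hcop : IsCoprime (ℓ * c) g)
    (χ : Polynomial F → ℂ) (hχ : IsPrimitiveChar ℓ χ)
    (φ : ℂ → ℂ) (hφ : IsRatCont (fun f => rChi χ f * eFrac (c * f) g) φ) :
    Filter.Tendsto (fun u : ℂ => (u - 1 / (q : ℂ)) * φ u / u ^ (n + 1))
      (nhdsWithin (1 / (q : ℂ)) {(1 / (q : ℂ))}ᶜ)
      (nhds (-((q : ℂ) ^ n * χ g * LFun χ 1 / (q : ℂ) ^ g.natDegree))) := by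
  subst hq
  obtain ⟨⟨P, Q, -, hQ, hPQ⟩, hsum⟩ := hφ
  have := tendsto_residue_of_eventually_geometric Fintype.card_pos
    (fun N hN => hχ.sum_rChi_mul_eFrac hℓ hℓdeg hg (IsCoprime.of_mul_left_left hcop)
      (IsCoprime.of_mul_left_right hcop) (N := N) hN) hQ hPQ
    (fun u hu => hasSum_sum_monicsOfDegree (hsum u hu)) n
  rwa [← mul_div_assoc, ← mul_assoc] at this
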